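/- Let Y ⊆ {0,1}^4 be the configuration Y = {(0,0,0,0),(1,1,0,0),(0,0,1,1),(1,1,1,1)} in Q_4. Then λ(Y,4) = 3/8. -/

import Mathlib

open Filter

namespace CubeDensity

/-- The automorphism of `Q_d` given by permuting coordinates by `σ` and then
complementing the values in the coordinates where `ε` is `true`. -/
def autMap (d : ℕ) (σ : Equiv.Perm (Fin d)) (ε : Fin d → Bool) (v : Fin d → Bool) :
    Fin d → Bool :=
  fun i => xor (v (σ⁻¹ i)) (ε i)

/-- `K` is an exact copy of `H` in `Q_d`: some automorphism of `Q_d` maps `H` onto `K`. -/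
def ExactCopy (d : ℕ) (H K : Set (Fin d → Bool)) : Prop :=
  ∃ σ : Equiv.Perm (Fin d), ∃ ε : Fin d → Bool, autMap d σ ε '' H = K

/-- The vertex of `Q_n` in the sub-`d`-cube with flip coordinates `F` (and fixed values `g`
outside `F`) corresponding to the vertex `u` of `Q_d`, identifying the flip coordinates
with `Fin d` in increasing order. -/
def embed {n d : ℕ} (F : Finset (Fin n)) (hF : F.card = d) (g : Fin n → Bool)
    (u : Fin d → Bool) : Fin n → Bool :=
  fun i => if h : i ∈ F then u ((F.orderIsoOfFin hF).symm ⟨i, h⟩) else g i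

/-- The sub-`d`-cube of `Q_n` with flip coordinates `F` and fixed values `g` outside `F`
is `H`-good for `S`: the configuration induced by `S` on it is an exact copy of `H`. -/
def IsGood {n d : ℕ} (H : Set (Fin d → Bool)) (S : Set (Fin n → Bool))
    (F : Finset (Fin n)) (hF : F.card = d) (g : Fin n → Bool) : Prop :=
  ExactCopy d H {u : Fin d → Bool | embed F hF g u ∈ S}

/-- The number of `H`-good sub-`d`-cubes of `Q_n`, where a sub-`d`-cube is encoded as a
pair `(F, g)` with `F` the `d`-element set of flip coordinates and `g` the fixed values
outside `F` (normalized to be `false` on `F`). -/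
noncomputable def goodCount (d : ℕ) (H : Set (Fin d → Bool)) (n : ℕ)
    (S : Set (Fin n → Bool)) : ℕ :=
  Nat.card {p : Finset (Fin n) × (Fin n → Bool) //
    ∃ hF : p.1.card = d, (∀ i ∈ p.1, p.2 i = false) ∧ IsGood H S p.1 hF p.2}

/-- `g(H,d,n,S)`: the fraction of the `C(n,d) * 2^(n-d)` sub-`d`-cubes of `Q_n` that are
`H`-good for `S`. -/
noncomputable def gFrac (d : ℕ) (H : Set (Fin d → Bool)) (n : ℕ)
    (S : Set (Fin n → Bool)) : ℝ :=
  (goodCount d H n S : ℝ) / ((n.choose d : ℝ) * 2 ^ (n - d))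

/-- `ex(H,d,n)`: the maximum over all `S ⊆ {0,1}^n` of the fraction of `H`-good
sub-`d`-cubes. -/
noncomputable def exD (d : ℕ) (H : Set (Fin d → Bool)) (n : ℕ) : ℝ :=
  ⨆ S : Set (Fin n → Bool), gFrac d H n S

end CubeDensity

namespace CubeDensity

abbrev Yc : Set (Fin 4 → Bool) := {![false, false, false, false], ![true, true, false, false],
          ![false, false, true, true], ![true, true, true, true]}

lemma mem_Yc (w : Fin 4 → Bool) : w ∈ Yc ↔ w 0 = w 1 ∧ w 2 = w 3 := by
  have : w = ![w 0, w 1, w 2, w 3] := by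
    funext i; fin_cases i <;> rfl
  rw [this]
  generalize w 0 = a
  generalize w 1 = b
  generalize w 2 = c
  generalize w 3 = d
  simp only [Yc, Set.mem_insert_iff, Set.mem_singleton_iff]
  revert a b c d
  decide

lemma mem_autMap_image (σ : Equiv.Perm (Fin 4)) (ε u : Fin 4 → Bool) :
    u ∈ autMap 4 σ ε '' Yc ↔ (fun i => xor (u (σ i)) (ε (σ i))) ∈ Yc := by
  constructor
  · rintro ⟨w, hw, rfl⟩
    convert hw using 1
    funext i
    simp [autMap]
  · intro h
    refine ⟨_, h, ?_⟩
    funext i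
    simp [autMap]

lemma exactCopy_iff (K : Set (Fin 4 → Bool)) :
    ExactCopy 4 Yc K ↔ ∃ σ : Equiv.Perm (Fin 4), ∃ k l : Bool, ∀ u, u ∈ K ↔
      (xor (u (σ 0)) (u (σ 1)) = k ∧ xor (u (σ 2)) (u (σ 3)) = l) := by
  constructor
  · rintro ⟨σ, ε, rfl⟩
    refine ⟨σ, xor (ε (σ 0)) (ε (σ 1)), xor (ε (σ 2)) (ε (σ 3)), fun u => ?_⟩
    rw [mem_autMap_image, mem_Yc]
    generalize u (σ 0) = a
    generalize u (σ 1) = b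
    generalize u (σ 2) = c
    generalize u (σ 3) = d
    generalize ε (σ 0) = a'
    generalize ε (σ 1) = b'
    generalize ε (σ 2) = c'
    generalize ε (σ 3) = d'
    refine and_congr ?_ ?_
    · revert a b a' b'; decide
    · revert c d c' d'; decide
  · rintro ⟨σ, k, l, h⟩
    refine ⟨σ, fun i => ![k, false, l, false] (σ⁻¹ i), ?_⟩
    ext u
    rw [mem_autMap_image, mem_Yc, h]
    simp only [Equiv.Perm.inv_def, Equiv.symm_apply_apply]
    generalize u (σ 0) = a
    generalize u (σ 1) = b
    generalize u (σ 2) = c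
    generalize u (σ 3) = d
    refine and_congr ?_ ?_
    · clear h; revert a b k l; decide
    · clear h; revert c d k l; decide

/-- flip a coordinate -/
def fl {α : Type*} [DecidableEq α] (v : α → Bool) (i : α) : α → Bool :=
  fun j => if j = i then !v j else v j

lemma fl_embed {n : ℕ} (F : Finset (Fin n)) (hF : F.card = 4) (g : Fin n → Bool)
    (u : Fin 4 → Bool) (j : Fin 4) :
    fl (embed F hF g u) (F.orderEmbOfFin hF j) = embed F hF g (fl u j) := by
  funext i
  by_cases h : i ∈ F
  · obtain ⟨k, hk⟩ := (F.orderIsoOfFin hF).surjective ⟨i, h⟩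
    have hi : i = F.orderEmbOfFin hF k := by
      rw [← Finset.coe_orderIsoOfFin_apply, hk]
    subst hi
    simp only [fl, embed, h, dite_true]
    rw [← hk, OrderIso.symm_apply_apply]
    simp
  · have : i ≠ F.orderEmbOfFin hF j := by
      rintro rfl
      exact h (Finset.orderEmbOfFin_mem _ _ _)
    simp [fl, embed, h, this]

lemma embed_apply {n : ℕ} (F : Finset (Fin n)) (hF : F.card = 4) (g : Fin n → Bool)
    (u : Fin 4 → Bool) (j : Fin 4) :
    embed F hF g u (F.orderEmbOfFin hF j) = u j := by
  have h : F.orderEmbOfFin hF j ∈ F := Finset.orderEmbOfFin_mem _ _ _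
  simp only [embed, h, dite_true]
  congr 1
  rw [OrderIso.symm_apply_eq]
  ext
  simp

/-- local pattern seen at a vertex of a good cube -/
def Pat {n : ℕ} (S : Set (Fin n → Bool)) (v : Fin n → Bool) (a b c d : Fin n) : Prop :=
  (v ∈ S ∧ fl (fl v a) b ∈ S ∧ fl (fl v c) d ∈ S ∧ fl (fl v a) c ∉ S ∧ fl (fl v a) d ∉ S ∧
    fl (fl v b) c ∉ S) ∨
  (v ∉ S ∧ ((fl v a ∈ S ∧ fl v b ∈ S ∧ fl v c ∉ S ∧ fl v d ∉ S ∧ fl (fl v c) d ∉ S) ∨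
    (fl v c ∈ S ∧ fl v d ∈ S ∧ fl v a ∉ S ∧ fl v b ∉ S ∧ fl (fl v a) b ∉ S) ∨
    (fl v a ∉ S ∧ fl v b ∉ S ∧ fl v c ∉ S ∧ fl v d ∉ S ∧ fl (fl v a) b ∉ S ∧
      fl (fl v c) d ∉ S ∧ fl (fl v a) c ∈ S ∧ fl (fl v a) d ∈ S ∧ fl (fl v b) c ∈ S)))

def dih : Fin 8 → Fin 4 → Fin 4 :=
  ![![0,1,2,3], ![1,0,2,3], ![0,1,3,2], ![1,0,3,2], ![2,3,0,1], ![3,2,0,1], ![2,3,1,0], ![3,2,1,0]]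

lemma pat_of_good {n : ℕ} (S : Set (Fin n → Bool)) (F : Finset (Fin n)) (hF : F.card = 4)
    (g : Fin n → Bool) (σ : Equiv.Perm (Fin 4)) (k l : Bool)
    (h : ∀ u, embed F hF g u ∈ S ↔
      (xor (u (σ 0)) (u (σ 1)) = k ∧ xor (u (σ 2)) (u (σ 3)) = l))
    (y : Fin 4 → Bool) (τ : Fin 8) :
    Pat S (embed F hF g y) (F.orderEmbOfFin hF (σ (dih τ 0))) (F.orderEmbOfFin hF (σ (dih τ 1)))
      (F.orderEmbOfFin hF (σ (dih τ 2))) (F.orderEmbOfFin hF (σ (dih τ 3))) := by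
  have hinj : ∀ i j, (σ i = σ j ↔ i = j) := fun i j => σ.injective.eq_iff
  simp only [Pat, fl_embed, h]
  simp only [fl, hinj]
  generalize y (σ 0) = a
  generalize y (σ 1) = b
  generalize y (σ 2) = c
  generalize y (σ 3) = d
  clear h hinj
  fin_cases τ <;> simp [dih] <;> revert k l a b c d <;> decide

lemma embed_inj {n : ℕ} (F : Finset (Fin n)) (hF : F.card = 4) (g g' : Fin n → Bool)
    (hg : ∀ i ∈ F, g i = false) (hg' : ∀ i ∈ F, g' i = false) (y y' : Fin 4 → Bool)
    (h : embed F hF g y = embed F hF g' y') : g = g' ∧ y = y' := by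
  constructor
  · funext i
    by_cases hi : i ∈ F
    · rw [hg i hi, hg' i hi]
    · have := congrFun h i
      simpa [embed, hi] using this
  · funext j
    have := congrFun h (F.orderEmbOfFin hF j)
    simpa [embed_apply] using this

lemma dih_inj : ∀ τ τ' : Fin 8, (∀ j, dih τ j = dih τ' j) → τ = τ' := by decide

lemma dih_surj : ∀ τ : Fin 8, ∀ j, ∃ i, dih τ i = j := by decide

open Classical in
lemma goodCount_le {n : ℕ} (S : Set (Fin n → Bool)) :
    goodCount 4 Yc n S * 128 ≤ ∑ v : Fin n → Bool,
      (Finset.univ.filter (fun p : (Fin n × Fin n) × (Fin n × Fin n) =>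
        Pat S v p.1.1 p.2.1 p.1.2 p.2.2)).card := by
  have hex : ∀ p : {p : Finset (Fin n) × (Fin n → Bool) //
    ∃ hF : p.1.card = 4, (∀ i ∈ p.1, p.2 i = false) ∧ IsGood Yc S p.1 hF p.2},
    ∃ hF : p.1.1.card = 4, ∃ σ : Equiv.Perm (Fin 4), ∃ k l : Bool, ∀ u,
      embed p.1.1 hF p.1.2 u ∈ S ↔
      (xor (u (σ 0)) (u (σ 1)) = k ∧ xor (u (σ 2)) (u (σ 3)) = l) := by
    rintro ⟨p, hF, -, hg⟩
    exact ⟨hF, (exactCopy_iff _).1 hg⟩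
  choose hF σ k l h using hex
  have hc : (Finset.univ : Finset ((Fin 4 → Bool) × Fin 8)).card = 128 := by simp
  rw [← Finset.card_sigma, goodCount, ← hc, Finset.card_univ, ← Nat.card_eq_fintype_card,
    ← Nat.card_prod, Nat.card_eq_fintype_card, ← Finset.card_univ]
  let f : ({p : Finset (Fin n) × (Fin n → Bool) //
    ∃ hF : p.1.card = 4, (∀ i ∈ p.1, p.2 i = false) ∧ IsGood Yc S p.1 hF p.2} ×
      ((Fin 4 → Bool) × Fin 8)) → (Σ _ : Fin n → Bool, (Fin n × Fin n) × (Fin n × Fin n)) :=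
    fun q =>
      let e := fun j => (q.1.1.1).orderEmbOfFin (hF q.1) (σ q.1 (dih q.2.2 j))
      ⟨embed q.1.1.1 (hF q.1) q.1.1.2 q.2.1, ((e 0, e 2), (e 1, e 3))⟩
  refine Finset.card_le_card_of_injOn f ?_ ?_
  · intro q _
    simp only [Finset.coe_sigma, Set.mem_sigma_iff, Finset.coe_univ, Set.mem_univ, true_and,
      Finset.coe_filter, Finset.mem_univ, Set.mem_ofPred_eq, f]
    exact pat_of_good S _ _ _ _ _ _ (h q.1) _ _
  · intro q _ q' _ hq
    simp only [f, Sigma.mk.injEq, heq_eq_eq, Prod.mk.injEq] at hq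
    obtain ⟨hv, ⟨h0, h2⟩, h1, h3⟩ := hq
    have hall : ∀ j, (q.1.1.1).orderEmbOfFin (hF q.1) (σ q.1 (dih q.2.2 j)) =
      (q'.1.1.1).orderEmbOfFin (hF q'.1) (σ q'.1 (dih q'.2.2 j)) := by
      intro j; fin_cases j
      exacts [h0, h1, h2, h3]
    have hFe : q.1.1.1 = q'.1.1.1 := by
      refine Finset.eq_of_subset_of_card_le ?_ (by rw [hF, hF])
      intro i hi
      have : i ∈ Set.range ((q.1.1.1).orderEmbOfFin (hF q.1)) := by
        rw [Finset.range_orderEmbOfFin]; exact hi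
      obtain ⟨j, rfl⟩ := this
      obtain ⟨j, rfl⟩ := (σ q.1).surjective j
      obtain ⟨j, rfl⟩ := dih_surj q.2.2 j
      rw [hall]
      exact Finset.orderEmbOfFin_mem _ _ _
    obtain ⟨⟨⟨F, g⟩, hp⟩, y, τ⟩ := q
    obtain ⟨⟨⟨F', g'⟩, hp'⟩, y', τ'⟩ := q'
    simp only at hFe
    subst hFe
    obtain ⟨rfl, rfl⟩ := embed_inj F _ g g' hp.2.1 hp'.2.1 y y' hv
    have : τ = τ' := by
      apply dih_inj
      intro j
      have := hall j
      simpa using this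
    rw [this]

end CubeDensity
namespace CubeDensity

open Classical in
lemma c4_bound {V : Type*} [DecidableEq V] (U : Finset V) (H : V → V → Prop)
    (hs : ∀ a b, H a b → H b a) :
    ((((U ×ˢ U) ×ˢ (U ×ˢ U)).filter (fun p => H p.1.1 p.1.2 ∧ (H p.2.1 p.1.2 ∧ ¬ H p.2.1 p.1.1) ∧
      (H p.2.2 p.1.1 ∧ ¬ H p.2.2 p.1.2))).card : ℝ) ≤ (U.card : ℝ) ^ 4 / 8 ∧
    ((((U ×ˢ U) ×ˢ (U ×ˢ U)).filter (fun p => H p.1.1 p.1.2 ∧ (H p.2.1 p.1.2 ∧ ¬ H p.2.1 p.1.1) ∧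
      (H p.2.2 p.1.1 ∧ ¬ H p.2.2 p.1.2))).card : ℝ) ≤
      (((U ×ˢ U).filter (fun p => H p.1 p.2)).card : ℝ) * (U.card : ℝ) ^ 2 / 4 := by
  set m : ℝ := (U.card : ℝ) with hm
  set X : V → V → Finset V := fun a c => U.filter (fun b => H b c ∧ ¬ H b a) with hX
  have hT : ((((U ×ˢ U) ×ˢ (U ×ˢ U)).filter (fun p => H p.1.1 p.1.2 ∧
      (H p.2.1 p.1.2 ∧ ¬ H p.2.1 p.1.1) ∧
      (H p.2.2 p.1.1 ∧ ¬ H p.2.2 p.1.2))).card : ℝ) =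
      ∑ p ∈ (U ×ˢ U).filter (fun p => H p.1 p.2),
        ((X p.1 p.2).card : ℝ) * ((X p.2 p.1).card : ℝ) := by
    have : (((U ×ˢ U) ×ˢ (U ×ˢ U)).filter (fun p => H p.1.1 p.1.2 ∧
      (H p.2.1 p.1.2 ∧ ¬ H p.2.1 p.1.1) ∧
      (H p.2.2 p.1.1 ∧ ¬ H p.2.2 p.1.2))).card =
      (((U ×ˢ U).filter (fun p => H p.1 p.2)).sigma
        (fun p => X p.1 p.2 ×ˢ X p.2 p.1)).card := by
      refine Finset.card_bij' (fun p _ => ⟨p.1, p.2⟩) (fun p _ => (p.1, p.2)) ?_ ?_ ?_ ?_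
      · intro p; simp [hX]; tauto
      · intro p; simp [hX]; tauto
      · intros; rfl
      · intros; rfl
    rw [this, Finset.card_sigma]
    push_cast
    simp
  have hsum : ∀ a c, ((X a c).card : ℝ) + ((X c a).card : ℝ) ≤ m := by
    intro a c
    rw [hm, ← Nat.cast_add, Nat.cast_le, ← Finset.card_union_of_disjoint]
    · apply Finset.card_le_card
      intro x; simp [hX]; tauto
    · rw [Finset.disjoint_left]
      intro x; simp [hX]; tauto
  have hnn : ∀ a c, (0 : ℝ) ≤ ((X a c).card : ℝ) := fun a c => Nat.cast_nonneg _
  rw [hT]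
  constructor
  · have h1 : ∑ p ∈ (U ×ˢ U).filter (fun p => H p.1 p.2),
        ((X p.1 p.2).card : ℝ) * ((X p.2 p.1).card : ℝ) ≤
        ∑ p ∈ (U ×ˢ U).filter (fun p => H p.1 p.2),
          (m / 4 * ((X p.1 p.2).card : ℝ) + m / 4 * ((X p.2 p.1).card : ℝ)) := by
      apply Finset.sum_le_sum
      intro p _
      have := hsum p.1 p.2
      have h1 := hnn p.1 p.2
      have h2 := hnn p.2 p.1
      nlinarith [sq_nonneg (((X p.1 p.2).card : ℝ) - ((X p.2 p.1).card : ℝ))]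
    have hsw : ∑ p ∈ (U ×ˢ U).filter (fun p => H p.1 p.2), ((X p.2 p.1).card : ℝ) =
        ∑ p ∈ (U ×ˢ U).filter (fun p => H p.1 p.2), ((X p.1 p.2).card : ℝ) := by
      refine Finset.sum_bij' (fun p _ => p.swap) (fun p _ => p.swap) ?_ ?_ ?_ ?_ ?_
      · rintro ⟨a, b⟩; simp; intro ha hb h; exact ⟨⟨hb, ha⟩, hs _ _ h⟩
      · rintro ⟨a, b⟩; simp; intro ha hb h; exact ⟨⟨hb, ha⟩, hs _ _ h⟩
      · intros; rfl
      · intros; rfl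
      · intros; rfl
    have h2 : ∑ p ∈ (U ×ˢ U).filter (fun p => H p.1 p.2), ((X p.1 p.2).card : ℝ) ≤
        m * (m ^ 2 / 4) := by
      calc ∑ p ∈ (U ×ˢ U).filter (fun p => H p.1 p.2), ((X p.1 p.2).card : ℝ)
          ≤ ∑ p ∈ (U ×ˢ U).filter (fun p => H p.1 p.2),
            ((U.filter (fun b => ¬ H b p.1)).card : ℝ) := by
            apply Finset.sum_le_sum
            intro p _
            rw [Nat.cast_le]
            apply Finset.card_le_card
            intro x; simp [hX]; tauto
        _ = ∑ a ∈ U, ((U.filter (fun b => H a b)).card : ℝ) *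
            ((U.filter (fun b => ¬ H b a)).card : ℝ) := by
            rw [Finset.sum_filter, Finset.sum_product]
            apply Finset.sum_congr rfl
            intro a _
            rw [← Finset.sum_filter]
            simp
        _ ≤ ∑ a ∈ U, m ^ 2 / 4 := by
            apply Finset.sum_le_sum
            intro a _
            have : U.filter (fun b => ¬ H b a) = U.filter (fun b => ¬ H a b) := by
              apply Finset.filter_congr
              intro x _
              exact not_congr ⟨hs _ _, hs _ _⟩
            rw [this]
            have h3 : ((U.filter (fun b => H a b)).card : ℝ) +
              ((U.filter (fun b => ¬ H a b)).card : ℝ) = m := by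
              rw [hm, ← Nat.cast_add, Finset.card_filter_add_card_filter_not]
            rw [← h3]
            nlinarith [sq_nonneg (((U.filter (fun b => H a b)).card : ℝ) -
              ((U.filter (fun b => ¬ H a b)).card : ℝ))]
        _ = m * (m ^ 2 / 4) := by simp [hm]
    have hm0 : 0 ≤ m := Nat.cast_nonneg _
    refine h1.trans ?_
    rw [Finset.sum_add_distrib, ← Finset.mul_sum, ← Finset.mul_sum, hsw]
    nlinarith [mul_le_mul_of_nonneg_left h2 hm0]
  · have : ∑ p ∈ (U ×ˢ U).filter (fun p => H p.1 p.2),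
        ((X p.1 p.2).card : ℝ) * ((X p.2 p.1).card : ℝ) ≤
        ∑ p ∈ (U ×ˢ U).filter (fun p => H p.1 p.2), m ^ 2 / 4 := by
      apply Finset.sum_le_sum
      intro p _
      have := hsum p.1 p.2
      have h1 := hnn p.1 p.2
      have h2 := hnn p.2 p.1
      nlinarith [sq_nonneg (((X p.1 p.2).card : ℝ) - ((X p.2 p.1).card : ℝ))]
    refine this.trans (le_of_eq ?_)
    rw [Finset.sum_const, nsmul_eq_mul]; ring

lemma arith (p m E T : ℝ) (hp : 0 ≤ p) (hm : 0 ≤ m) (hE : 0 ≤ E)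
    (h1 : T ≤ m ^ 4 / 8) (h2 : T ≤ E * m ^ 2 / 4) :
    2 * (p ^ 2 * (m ^ 2 - E)) + T ≤ (p + m) ^ 4 / 8 := by
  have k0 : p ^ 2 * m ^ 2 + m ^ 4 / 8 ≤ (p + m) ^ 4 / 8 := by
    have hpm := mul_nonneg hp hm
    nlinarith [mul_nonneg hpm (sq_nonneg (p - m)), pow_nonneg hp 4, mul_nonneg hpm hpm]
  have k1 : 2 * p ^ 2 * m ^ 2 ≤ (p + m) ^ 4 / 8 := by
    have hpm := mul_nonneg hp hm
    have : 4 * (p * m) ≤ (p + m) ^ 2 := by nlinarith [sq_nonneg (p - m)]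
    have := pow_le_pow_left₀ (by positivity) this 2
    nlinarith
  by_cases hc : m ^ 2 / 2 ≤ E
  · nlinarith [mul_le_mul_of_nonneg_left hc (sq_nonneg p)]
  · push Not at hc
    have hm2 : 0 < m ^ 2 := by linarith
    have : (m ^ 2) * (2 * (p ^ 2 * (m ^ 2 - E)) + E * m ^ 2 / 4) ≤ m ^ 2 * ((p + m) ^ 4 / 8) := by
      have e1 := mul_le_mul_of_nonneg_left k0 (show 0 ≤ 2 * E by linarith)
      have e2 := mul_le_mul_of_nonneg_left k1 (show 0 ≤ m ^ 2 - 2 * E by linarith)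
      nlinarith
    have := le_of_mul_le_mul_left this hm2
    linarith

lemma fl_comm {α : Type*} [DecidableEq α] (v : α → Bool) (i j : α) :
    fl (fl v i) j = fl (fl v j) i := by
  funext k
  simp only [fl]
  split_ifs <;> rfl

open Classical in
lemma pat_bound {n : ℕ} (S : Set (Fin n → Bool)) (v : Fin n → Bool) :
    ((Finset.univ.filter (fun p : (Fin n × Fin n) × (Fin n × Fin n) =>
        Pat S v p.1.1 p.2.1 p.1.2 p.2.2)).card : ℝ) ≤ (n : ℝ) ^ 4 / 8 := by
  by_cases hv : v ∈ S
  · have h := (c4_bound (Finset.univ : Finset (Fin n)) (fun a b => fl (fl v a) b ∉ S)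
      (fun a b h => by rwa [fl_comm])).1
    simp only [Finset.card_univ, Fintype.card_fin] at h
    refine le_trans ?_ h
    rw [Nat.cast_le]
    apply Finset.card_le_card
    rintro ⟨⟨a, c⟩, b, d⟩
    simp only [Pat, hv, Finset.mem_filter, Finset.mem_univ, Finset.mem_product, true_and, not_true,
      false_and, or_false, not_not]
    rw [fl_comm v b a, fl_comm v d a, fl_comm v d c]
    tauto
  · set N : Finset (Fin n) := Finset.univ.filter (fun i => fl v i ∈ S) with hN
    set U : Finset (Fin n) := Finset.univ.filter (fun i => ¬ fl v i ∈ S) with hU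
    obtain ⟨h1, h2⟩ := c4_bound U (fun a b => fl (fl v a) b ∈ S)
      (fun a b h => by rwa [fl_comm])
    have hNU : (N.card : ℝ) + U.card = n := by
      rw [hN, hU, ← Nat.cast_add, Finset.card_filter_add_card_filter_not]
      simp
    set T := ((U ×ˢ U) ×ˢ (U ×ˢ U)).filter (fun p => fl (fl v p.1.1) p.1.2 ∈ S ∧
      (fl (fl v p.2.1) p.1.2 ∈ S ∧ ¬ fl (fl v p.2.1) p.1.1 ∈ S) ∧
      (fl (fl v p.2.2) p.1.1 ∈ S ∧ ¬ fl (fl v p.2.2) p.1.2 ∈ S)) with hT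
    set E := (U ×ˢ U).filter (fun p => fl (fl v p.1) p.2 ∈ S) with hE
    set E' := (U ×ˢ U).filter (fun p => ¬ fl (fl v p.1) p.2 ∈ S) with hE'
    have hEE : (E.card : ℝ) + E'.card = (U.card : ℝ) ^ 2 := by
      rw [hE, hE', ← Nat.cast_add, Finset.card_filter_add_card_filter_not, Finset.card_product]
      push_cast; ring
    have key := arith N.card U.card E.card T.card (Nat.cast_nonneg _) (Nat.cast_nonneg _)
      (Nat.cast_nonneg _) h1 h2
    rw [hNU] at key
    refine le_trans ?_ key
    set e1 : ((Fin n × Fin n) × (Fin n × Fin n)) → ((Fin n × Fin n) × (Fin n × Fin n)) :=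
      fun p => ((p.1.1, p.2.1), (p.1.2, p.2.2)) with he1
    set e2 : ((Fin n × Fin n) × (Fin n × Fin n)) → ((Fin n × Fin n) × (Fin n × Fin n)) :=
      fun p => ((p.2.1, p.1.1), (p.2.2, p.1.2)) with he2
    have hsub : (Finset.univ.filter (fun p : (Fin n × Fin n) × (Fin n × Fin n) =>
        Pat S v p.1.1 p.2.1 p.1.2 p.2.2)) ⊆
        ((((N ×ˢ N) ×ˢ E').image e1) ∪ (((N ×ˢ N) ×ˢ E').image e2)) ∪ T := by
      rintro ⟨⟨a, c⟩, b, d⟩ h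
      simp only [Pat, hv, Finset.mem_filter, Finset.mem_univ, true_and, not_false_eq_true,
        false_and, false_or] at h
      simp only [Finset.mem_union]
      rcases h with h | h | h
      · left; left
        refine Finset.mem_image.2 ⟨((a, b), (c, d)), ?_, rfl⟩
        simp [hN, hE', hU]; tauto
      · left; right
        refine Finset.mem_image.2 ⟨((c, d), (a, b)), ?_, rfl⟩
        simp [hN, hE', hU]; tauto
      · right
        simp only [hT, hU, Finset.mem_filter, Finset.mem_univ, Finset.mem_product, true_and]
        rw [fl_comm v b a, fl_comm v d a, fl_comm v d c]
        tauto
    have hc := (Finset.card_le_card hsub).trans ((Finset.card_union_le _ _).trans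
      (Nat.add_le_add_right (Finset.card_union_le _ _) _))
    have i1 := Finset.card_image_le (s := (N ×ˢ N) ×ˢ E') (f := e1)
    have i2 := Finset.card_image_le (s := (N ×ˢ N) ×ˢ E') (f := e2)
    have hc' := hc.trans (Nat.add_le_add_right (Nat.add_le_add i1 i2) _)
    have hc2 : ((Finset.univ.filter (fun p : (Fin n × Fin n) × (Fin n × Fin n) =>
        Pat S v p.1.1 p.2.1 p.1.2 p.2.2)).card : ℝ) ≤ _ := Nat.cast_le.2 hc'
    refine hc2.trans (le_of_eq ?_)
    rw [← hEE]
    simp only [Finset.card_product]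
    push_cast
    ring

lemma goodCount_le' {n : ℕ} (S : Set (Fin n → Bool)) :
    (goodCount 4 Yc n S : ℝ) ≤ 2 ^ n * (n : ℝ) ^ 4 / 1024 := by
  classical
  have h := goodCount_le S
  have h' : (goodCount 4 Yc n S : ℝ) * 128 ≤ ∑ v : Fin n → Bool, (n : ℝ) ^ 4 / 8 := by
    refine le_trans ?_ (Finset.sum_le_sum fun v _ => pat_bound S v)
    exact_mod_cast h
  simp at h'
  linarith

lemma gFrac_le {n : ℕ} (hn : 4 ≤ n) (S : Set (Fin n → Bool)) :
    gFrac 4 Yc n S ≤ 3 / 8 * ((n : ℝ) ^ 4 / (n * (n - 1) * (n - 2) * (n - 3))) := by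
  have h := goodCount_le' S
  have hn' : (4 : ℝ) ≤ n := by exact_mod_cast hn
  have hch : (n.choose 4 : ℝ) = n * (n - 1) * (n - 2) * (n - 3) / 24 := by
    rw [Nat.cast_choose_eq_descPochhammer_div]
    simp [descPochhammer_succ_right, Nat.factorial]
  have h2 : (2 : ℝ) ^ n = 16 * 2 ^ (n - 4) := by
    obtain ⟨k, rfl⟩ := Nat.exists_eq_add_of_le hn
    rw [pow_add]; simp; norm_num
  have p0 : 0 < (n : ℝ) * (n - 1) * (n - 2) * (n - 3) := by
    have : (0 : ℝ) < n := by linarith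
    have : (0 : ℝ) < n - 1 := by linarith
    have : (0 : ℝ) < n - 2 := by linarith
    have : (0 : ℝ) < n - 3 := by linarith
    positivity
  rw [gFrac, hch]
  generalize hD : (n : ℝ) * (n - 1) * (n - 2) * (n - 3) = D at *
  rw [div_le_iff₀ (by positivity)]
  rw [h2] at h
  refine h.trans (le_of_eq ?_)
  field_simp
  norm_num

end CubeDensity
namespace CubeDensity

/-- parity weight of a vertex on the coordinates where `A` is true -/
def par {α : Type*} [Fintype α] (A : α → Bool) (x : α → Bool) : ZMod 2 :=
  ∑ i, if A i then (if x i then 1 else 0) else 0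

lemma par_embed {n : ℕ} (A : Fin n → Bool) (F : Finset (Fin n)) (hF : F.card = 4)
    (g : Fin n → Bool) (hg : ∀ i ∈ F, g i = false) (u : Fin 4 → Bool) :
    par A (embed F hF g u) = par (fun j => A (F.orderEmbOfFin hF j)) u + par A g := by
  have h1 : ∀ f : Fin n → ZMod 2, ∑ i ∈ F, f i = ∑ j, f (F.orderEmbOfFin hF j) := by
    intro f
    conv_lhs => rw [← Finset.map_orderEmbOfFin_univ F hF]
    rw [Finset.sum_map]
    rfl
  unfold par
  rw [← Finset.sum_add_sum_compl F, ← Finset.sum_add_sum_compl F (fun i => if A i then (if g i then (1 : ZMod 2) else 0) else 0),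
    h1]
  simp only [embed_apply]
  congr 1
  rw [Finset.sum_eq_zero (s := F), zero_add]
  · apply Finset.sum_congr rfl
    intro i hi
    simp [embed, Finset.mem_compl.1 hi]
  · intro i hi
    simp [hg i hi]

lemma exists_perm : ∀ A : Fin 4 → Bool, (Finset.univ.filter (fun i => A i = true)).card = 2 →
    ∃ σ : Equiv.Perm (Fin 4), A (σ 0) = true ∧ A (σ 1) = true ∧ A (σ 2) = false ∧
      A (σ 3) = false := by
  decide

lemma isGood_par {n : ℕ} (A : Fin n → Bool) (F : Finset (Fin n)) (hF : F.card = 4)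
    (hA : (F.filter (fun i => A i = true)).card = 2)
    (g : Fin n → Bool) (hg : ∀ i ∈ F, g i = false) :
    IsGood Yc {x | par A x = 0 ∧ par (fun i => !A i) x = 0} F hF g := by
  rw [IsGood, exactCopy_iff]
  obtain ⟨σ, h0, h1, h2, h3⟩ := exists_perm (fun j => A (F.orderEmbOfFin hF j)) (by
    rw [← hA]
    conv_rhs => rw [← Finset.map_orderEmbOfFin_univ F hF]
    rw [Finset.filter_map, Finset.card_map]
    rfl)
  refine ⟨σ, decide (par A g = 1), decide (par (fun i => !A i) g = 1), fun u => ?_⟩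
  change (par A _ = 0 ∧ par _ _ = 0) ↔ _
  rw [par_embed _ _ _ _ hg, par_embed _ _ _ _ hg]
  generalize par A g = p
  generalize par (fun i => !A i) g = q
  unfold par
  rw [← Equiv.sum_comp σ, ← Equiv.sum_comp σ (fun j => if (!A (F.orderEmbOfFin hF j)) = true then (if u j then (1 : ZMod 2) else 0) else 0)]
  simp only [Fin.sum_univ_four, h0, h1, h2, h3]
  simp only [Bool.not_true, Bool.not_false, if_true, Bool.false_eq_true, if_false, add_zero,
    zero_add]
  generalize u (σ 0) = a
  generalize u (σ 1) = b
  generalize u (σ 2) = c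
  generalize u (σ 3) = d
  refine and_congr ?_ ?_
  · revert a b p; decide
  · revert c d q; decide

open Classical in
lemma goodCount_ge {n : ℕ} (A : Fin n → Bool) :
    ((Finset.univ.filter (fun i => A i = true)).card.choose 2) *
      ((Finset.univ.filter (fun i => A i = false)).card.choose 2) * 2 ^ (n - 4) ≤
    goodCount 4 Yc n {x | par A x = 0 ∧ par (fun i => !A i) x = 0} := by
  set P := Finset.univ.filter (fun i => A i = true) with hP
  set Q := Finset.univ.filter (fun i => A i = false) with hQ
  set B : Finset ((Finset (Fin n) × Finset (Fin n))) := P.powersetCard 2 ×ˢ Q.powersetCard 2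
    with hB
  have hPQ : ∀ s t : Finset (Fin n), (s, t) ∈ B →
      (s ∪ t).card = 4 ∧ (s ∪ t).filter (fun i => A i = true) = s ∧
        (s ∪ t).filter (fun i => A i = false) = t ∧ s.card = 2 := by
    intro s t h
    simp only [hB, Finset.mem_product, Finset.mem_powersetCard] at h
    obtain ⟨⟨hs, hs2⟩, ht, ht2⟩ := h
    have hs' : ∀ i ∈ s, A i = true := fun i hi => by simpa [hP] using hs hi
    have ht' : ∀ i ∈ t, A i = false := fun i hi => by simpa [hQ] using ht hi
    refine ⟨?_, ?_, ?_, hs2⟩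
    · rw [Finset.card_union_of_disjoint, hs2, ht2]
      rw [Finset.disjoint_left]
      intro i h1 h2
      have := hs' i h1
      rw [ht' i h2] at this
      exact absurd this (by simp)
    · ext i
      simp only [Finset.mem_filter, Finset.mem_union]
      constructor
      · rintro ⟨h | h, h'⟩
        · exact h
        · rw [ht' i h] at h'; exact absurd h' (by simp)
      · intro h; exact ⟨Or.inl h, hs' i h⟩
    · ext i
      simp only [Finset.mem_filter, Finset.mem_union]
      constructor
      · rintro ⟨h | h, h'⟩
        · rw [hs' i h] at h'; exact absurd h' (by simp)
        · exact h
      · intro h; exact ⟨Or.inr h, ht' i h⟩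
  set G : Finset (Fin n) → Finset (Fin n → Bool) := fun F =>
    Fintype.piFinset (fun i => if i ∈ F then {false} else Finset.univ) with hG
  have hGc : ∀ F : Finset (Fin n), F.card = 4 → (G F).card = 2 ^ (n - 4) := by
    intro F hF
    rw [hG, Fintype.card_piFinset]
    have : ∀ i, (if i ∈ F then ({false} : Finset Bool) else Finset.univ).card =
      if i ∈ F then 1 else 2 := by
      intro i; split_ifs <;> simp
    simp only [this]
    rw [Finset.prod_ite]
    simp only [Finset.prod_const, one_pow, one_mul]
    congr 1
    rw [Finset.filter_not, Finset.card_sdiff_of_subset (Finset.filter_subset _ _)]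
    simp [hF]
  have hcard : (B.sigma (fun p => G (p.1 ∪ p.2))).card =
      P.card.choose 2 * Q.card.choose 2 * 2 ^ (n - 4) := by
    rw [Finset.card_sigma, Finset.sum_congr rfl (g := fun _ => 2 ^ (n - 4))]
    · simp [hB]
    · rintro ⟨s, t⟩ h
      exact hGc _ (hPQ s t h).1
  rw [← hcard, goodCount, Nat.card_eq_fintype_card, Fintype.card_subtype]
  refine Finset.card_le_card_of_injOn (fun p => (p.1.1 ∪ p.1.2, p.2)) ?_ ?_
  · rintro ⟨⟨s, t⟩, g⟩ h
    have h := Finset.mem_sigma.1 (Finset.mem_coe.1 h)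
    obtain ⟨hst, hg⟩ := h
    have hg' : ∀ i ∈ s ∪ t, g i = false := by
      intro i hi
      have := Fintype.mem_piFinset.1 hg i
      simpa only [hi, if_true, Finset.mem_singleton] using this
    obtain ⟨h4, h1, h2, h3⟩ := hPQ s t hst
    simp only [Finset.coe_filter, Finset.mem_univ, true_and]
    exact ⟨h4, hg', isGood_par A _ h4 (by rw [h1, h3]) g hg'⟩
  · rintro ⟨⟨s, t⟩, g⟩ h ⟨⟨s', t'⟩, g'⟩ h' he
    have h := (Finset.mem_sigma.1 (Finset.mem_coe.1 h)).1
    have h' := (Finset.mem_sigma.1 (Finset.mem_coe.1 h')).1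
    simp only [Prod.mk.injEq] at he
    obtain ⟨he, rfl⟩ := he
    obtain ⟨-, h1, h2, -⟩ := hPQ s t h
    obtain ⟨-, h1', h2', -⟩ := hPQ s' t' h'
    have e1 : s = s' := by rw [← h1, ← h1', he]
    have e2 : t = t' := by rw [← h2, ← h2', he]
    rw [e1, e2]

lemma exists_ge {n : ℕ} (hn : 4 ≤ n) : ∃ S : Set (Fin n → Bool), 3 / 8 ≤ gFrac 4 Yc n S := by
  let A : Fin n → Bool := fun i => decide (i.val < n / 2)
  refine ⟨{x | par A x = 0 ∧ par (fun i => !A i) x = 0}, ?_⟩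
  · have h := goodCount_ge A
    have hP : (Finset.univ.filter (fun i => A i = true)).card = n / 2 := by
      simp only [A, decide_eq_true_eq]
      rw [Fin.card_filter_val_lt]
      omega
    have hQ : (Finset.univ.filter (fun i => A i = false)).card = n - n / 2 := by
      have h1 := Finset.card_filter_add_card_filter_not (s := (Finset.univ : Finset (Fin n)))
        (fun i => A i = true)
      simp only [Bool.not_eq_true, Finset.card_univ, Fintype.card_fin] at h1
      omega
    rw [hP, hQ] at h
    have hh : ((n / 2).choose 2 : ℝ) * ((n - n / 2).choose 2 : ℝ) * 2 ^ (n - 4) ≤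
      (goodCount 4 Yc n {x | par A x = 0 ∧ par (fun i => !A i) x = 0} : ℝ) := by
      exact_mod_cast h
    have hn' : (4 : ℝ) ≤ n := by exact_mod_cast hn
    have hch : (n.choose 4 : ℝ) = n * (n - 1) * (n - 2) * (n - 3) / 24 := by
      rw [Nat.cast_choose_eq_descPochhammer_div]
      simp [descPochhammer_succ_right, Nat.factorial]
    have p0 : 0 < (n : ℝ) * (n - 1) * (n - 2) * (n - 3) := by
      have : (0 : ℝ) < n := by linarith
      have : (0 : ℝ) < n - 1 := by linarith
      have : (0 : ℝ) < n - 2 := by linarith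
      have : (0 : ℝ) < n - 3 := by linarith
      positivity
    have key : (3 : ℝ) / 8 * (n * (n - 1) * (n - 2) * (n - 3) / 24) ≤
        ((n / 2).choose 2 : ℝ) * ((n - n / 2).choose 2 : ℝ) := by
      rw [Nat.cast_choose_two, Nat.cast_choose_two]
      obtain ⟨m, hm | hm⟩ := Nat.even_or_odd' n
      · have e1 : n / 2 = m := by omega
        have e2 : n - n / 2 = m := by omega
        rw [e2, e1, hm]
        have : (2 : ℝ) ≤ m := by exact_mod_cast (by omega : 2 ≤ m)
        push_cast
        have h3 : (0 : ℝ) ≤ m * (m - 1) * (4 * m - 3) :=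
          mul_nonneg (mul_nonneg (by linarith) (by linarith)) (by linarith)
        nlinarith
      · have e1 : n / 2 = m := by omega
        have e2 : n - n / 2 = m + 1 := by omega
        rw [e2, e1, hm]
        have : (2 : ℝ) ≤ m := by exact_mod_cast (by omega : 2 ≤ m)
        push_cast
        have h3 : (0 : ℝ) ≤ m * (m - 1) * (4 * m + 1) :=
          mul_nonneg (mul_nonneg (by linarith) (by linarith)) (by linarith)
        nlinarith
    rw [gFrac, hch, le_div_iff₀ (by positivity)]
    refine le_trans ?_ hh
    rw [← mul_assoc]
    exact mul_le_mul_of_nonneg_right key (by positivity)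

theorem main : Tendsto (fun n => exD 4 Yc n) atTop (nhds (3 / 8 : ℝ)) := by
  have hlim : Tendsto (fun n : ℕ => (3 / 8 : ℝ) *
      ((n : ℝ) ^ 4 / (n * (n - 1) * (n - 2) * (n - 3)))) atTop (nhds (3 / 8 : ℝ)) := by
    have h0 := tendsto_inv_atTop_nhds_zero_nat (𝕜 := ℝ)
    have h1 : Tendsto (fun n : ℕ => (3 / 8 : ℝ) * ((1 - (n : ℝ)⁻¹) * (1 - 2 * (n : ℝ)⁻¹) *
      (1 - 3 * (n : ℝ)⁻¹))⁻¹) atTop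
      (nhds ((3 / 8 : ℝ) * ((1 - 0) * (1 - 2 * 0) * (1 - 3 * 0))⁻¹)) := by
      refine Tendsto.const_mul _ (Tendsto.inv₀ ?_ (by norm_num))
      exact ((h0.const_sub 1).mul ((h0.const_mul 2).const_sub 1)).mul
        ((h0.const_mul 3).const_sub 1)
    have h2 : ((3 / 8 : ℝ) * ((1 - 0) * (1 - 2 * 0) * (1 - 3 * 0))⁻¹) = 3 / 8 := by norm_num
    rw [h2] at h1
    refine h1.congr' ?_
    filter_upwards [eventually_ge_atTop 4] with n hn
    have hn' : (4 : ℝ) ≤ n := by exact_mod_cast hn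
    have : (n : ℝ) ≠ 0 := by linarith
    have : (n : ℝ) - 1 ≠ 0 := by linarith
    have : (n : ℝ) - 2 ≠ 0 := by linarith
    have : (n : ℝ) - 3 ≠ 0 := by linarith
    field_simp
  refine tendsto_of_tendsto_of_tendsto_of_le_of_le' tendsto_const_nhds hlim ?_ ?_
  · filter_upwards [eventually_ge_atTop 4] with n hn
    obtain ⟨S, hS⟩ := exists_ge hn
    exact hS.trans (le_ciSup (f := fun S => gFrac 4 Yc n S) (Set.finite_range _).bddAbove S)
  · filter_upwards [eventually_ge_atTop 4] with n hn
    exact ciSup_le fun S => gFrac_le hn S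

end CubeDensity
/-- λ(Y, 4) = 3/8, where Y = {(0,0,0,0),(1,1,0,0),(0,0,1,1),(1,1,1,1)} in Q₄. -/
theorem dCubeDensity_Y :
    Filter.Tendsto
      (fun n => CubeDensity.exD 4
        ({![false, false, false, false], ![true, true, false, false],
          ![false, false, true, true], ![true, true, true, true]} : Set (Fin 4 → Bool)) n)
      Filter.atTop (nhds (3 / 8 : ℝ)) := by
  exact CubeDensity.main
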